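/- Let 1 ≤ k ≤ d be integers, n ≥ 2, C_n = 4/(n² − n), V a d×d orthogonal matrix, D = diag(σ_1,…,σ_d) with σ_1 ≥ … ≥ σ_d > 0, and Σ = C_n V D² Vᵀ. Let ξ ~ N(0, Σ), let η = Vᵀξ, define M_k = Σ_{j=1}^k η_j²/(C_n σ_j²), let a_k > 0, and set v_{a_k} = P(χ²_{k+2} ≤ a_k)/P(χ²_k ≤ a_k). Then the conditional covariance matrix of ξ given the event {M_k ≤ a_k} equals C_n · V · diag(v_{a_k} σ_1², …, v_{a_k} σ_k², σ_{k+1}², …, σ_d²) · Vᵀ; that is, conditioning on {M_k ≤ a_k} multiplies the variance of each of the top k principal components by v_{a_k} and leaves the covariance of the remaining d − k components unchanged. -/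

import Mathlib

open MeasureTheory ProbabilityTheory Matrix Finset

/-- `P(χ²_m ≤ a)`: the CDF at `a` of the chi-squared distribution with `m` degrees of
freedom, i.e. the Gamma distribution with shape `m/2` and rate `1/2`. -/
noncomputable def chiSqCDF (m : ℕ) (a : ℝ) : ℝ :=
  (gammaMeasure ((m : ℝ) / 2) (1 / 2) (Set.Iic a)).toReal

@[fun_prop]
lemma measurable_gammaPDF (a r : ℝ) : Measurable (gammaPDF a r) :=
  (measurable_gammaPDFReal a r).ennreal_ofReal

/-- Integration against a gamma distribution, written on the half-line with its density. -/
lemma integral_gammaMeasure {a r : ℝ} (ha : 0 < a) (hr : 0 < r) (f : ℝ → ℝ) :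
    ∫ x, f x ∂(gammaMeasure a r) =
      ∫ x in Set.Ioi 0, r ^ a / Real.Gamma a * x ^ (a - 1) * Real.exp (-(r * x)) * f x := by
  rw [gammaMeasure, integral_withDensity_eq_integral_toReal_smul
    (measurable_gammaPDF a r)
    (ae_of_all _ fun _ ↦ ENNReal.ofReal_lt_top), ← integral_Ici_eq_integral_Ioi,
    ← integral_indicator measurableSet_Ici]
  congr 1 with x
  rw [gammaPDF, ENNReal.toReal_ofReal (gammaPDFReal_nonneg ha hr x), gammaPDFReal]
  by_cases hx : 0 ≤ x <;> simp [hx]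

lemma mgf_gammaMeasure_of_lt {a r t : ℝ} (ha : 0 < a) (hr : 0 < r) (ht : t < r) :
    mgf id (gammaMeasure a r) t = (r / (r - t)) ^ a := by
  have hrt : 0 < r - t := sub_pos.2 ht
  have hG := (Real.Gamma_pos_of_pos ha).ne'
  rw [mgf, integral_gammaMeasure ha hr]
  calc _ = ∫ x in Set.Ioi 0, r ^ a / Real.Gamma a *
        (x ^ (a - 1) * Real.exp (-((r - t) * x))) := by
        congr 1 with x
        rw [id, mul_assoc, mul_assoc, ← Real.exp_add]
        ring_nf
    _ = _ := by
        rw [integral_const_mul, Real.integral_rpow_mul_exp_neg_mul_Ioi ha hrt,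
          Real.div_rpow hr.le hrt.le, Real.div_rpow zero_le_one hrt.le, Real.one_rpow]
        field_simp

lemma mgf_gammaMeasure_of_le {a r t : ℝ} (ha : 0 < a) (hr : 0 < r) (ht : r ≤ t) :
    mgf id (gammaMeasure a r) t = 0 := by
  rw [mgf, integral_gammaMeasure ha hr]
  refine integral_undef fun h ↦ not_integrableOn_Ioi_rpow (a - 1) ?_
  have hG := Real.Gamma_pos_of_pos ha
  have hra := Real.rpow_pos_of_pos hr a
  refine Integrable.mono' (h.const_mul (Real.Gamma a / r ^ a))
    (by fun_prop) ((ae_restrict_iff' measurableSet_Ioi).2 (ae_of_all _ fun x hx ↦ ?_))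
  have hx : 0 < x := hx
  have hpow := Real.rpow_pos_of_pos hx (a - 1)
  have hexp : 1 ≤ Real.exp (-(r * x)) * Real.exp (t * id x) := by
    rw [← Real.exp_add, Real.one_le_exp_iff, id]
    nlinarith
  rw [Real.norm_of_nonneg hpow.le]
  calc x ^ (a - 1) ≤ x ^ (a - 1) * (Real.exp (-(r * x)) * Real.exp (t * id x)) :=
        le_mul_of_one_le_right hpow.le hexp
    _ = _ := by field_simp

lemma mgf_sq_gaussianReal (t : ℝ) :
    mgf (fun x ↦ x ^ 2) (gaussianReal 0 1) t = √((1 / 2) / (1 / 2 - t)) := by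
  rw [mgf, integral_gaussianReal_eq_integral_smul one_ne_zero]
  calc _ = ∫ x : ℝ, (√(2 * Real.pi))⁻¹ * Real.exp (-(1 / 2 - t) * x ^ 2) := by
        congr 1 with x
        rw [gaussianPDFReal, smul_eq_mul, mul_assoc, ← Real.exp_add]
        simp only [NNReal.coe_one, mul_one, sub_zero]
        ring_nf
    _ = _ := by
        rw [integral_const_mul, integral_gaussian, ← Real.sqrt_inv, ← Real.sqrt_mul (by positivity)]
        congr 1
        have := Real.pi_ne_zero
        field_simp

/-- Probability measures on the real line with the same moment-generating function, finite in a
neighbourhood of zero, are equal. -/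
lemma ext_of_mgf_id_eq {P Q : Measure ℝ} [IsProbabilityMeasure P] [IsProbabilityMeasure Q]
    (h : mgf id P = mgf id Q) (h0 : 0 ∈ interior (integrableExpSet id P)) : P = Q := by
  refine Measure.ext_of_charFun (funext fun t ↦ ?_)
  rw [← complexMGF_id_mul_I, ← complexMGF_id_mul_I]
  exact eqOn_complexMGF_of_mgf h (by simpa using h0)

/-- The sum of the squares of `m ≥ 1` standard Gaussian coordinates is chi-squared with `m` degrees
of freedom. -/
lemma map_sum_sq_pi_gaussianReal {ι : Type*} [Fintype ι] {S : Finset ι} (hS : S.Nonempty) :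
    (Measure.pi fun _ : ι ↦ gaussianReal 0 1).map (fun x ↦ ∑ j ∈ S, x j ^ 2) =
      gammaMeasure ((#S : ℝ) / 2) (1 / 2) := by
  have hcard : (0 : ℝ) < #S / 2 := by
    have := Finset.card_pos.2 hS
    positivity
  have := isProbabilityMeasure_gammaMeasure hcard (r := 1 / 2) (by norm_num)
  have hmeas : Measurable fun x : ι → ℝ ↦ ∑ j ∈ S, x j ^ 2 := by fun_prop
  have := Measure.isProbabilityMeasure_map (μ := Measure.pi fun _ : ι ↦ gaussianReal 0 1)
    hmeas.aemeasurable
  have hmgf (t : ℝ) : mgf id (gammaMeasure ((#S : ℝ) / 2) (1 / 2)) t =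
      √((1 / 2) / (1 / 2 - t)) ^ #S := by
    rcases lt_or_ge t (1 / 2) with ht | ht
    · have : 0 ≤ 1 / 2 / (1 / 2 - t) := div_nonneg (by norm_num) (by linarith)
      rw [mgf_gammaMeasure_of_lt hcard (by norm_num) ht, Real.sqrt_eq_rpow, ← Real.rpow_natCast,
        ← Real.rpow_mul this]
      ring_nf
    · rw [mgf_gammaMeasure_of_le hcard (by norm_num) ht, Real.sqrt_eq_zero_of_nonpos
        (div_nonpos_of_nonneg_of_nonpos (by norm_num) (by linarith)),
        zero_pow (Finset.card_pos.2 hS).ne']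
  symm
  refine ext_of_mgf_id_eq (funext fun t ↦ ?_) ?_
  · have hsum : (fun x : ι → ℝ ↦ ∑ j ∈ S, x j ^ 2) = ∑ j ∈ S, fun x : ι → ℝ ↦ x j ^ 2 := by
      ext x; simp
    have hcoord (j : ι) : mgf (fun x : ι → ℝ ↦ x j ^ 2) (Measure.pi fun _ ↦ gaussianReal 0 1) t =
        √((1 / 2) / (1 / 2 - t)) := by
      have hj := measurePreserving_eval (fun _ : ι ↦ gaussianReal 0 1) j
      rw [← mgf_sq_gaussianReal]
      conv_rhs => rw [← hj.map_eq]
      exact (mgf_map (t := t) (X := fun x : ℝ ↦ x ^ 2) hj.aemeasurable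
        (Measurable.aestronglyMeasurable (by fun_prop))).symm
    rw [hmgf, mgf_id_map hmeas.aemeasurable, hsum, (iIndepFun_pi (X := fun (_ : ι) (x : ℝ) ↦ x ^ 2)
      (by fun_prop)).mgf_sum (by fun_prop)]
    simp only [hcoord, prod_const]
  · refine mem_interior.2 ⟨Set.Iio (1 / 2), fun t ht ↦ ?_, isOpen_Iio, by simp⟩
    rw [integrableExpSet, Set.mem_ofPred_eq, ← mgf_pos_iff, hmgf]
    have : 0 < 1 / 2 - t := sub_pos.2 ht
    positivity

/-- Weighting a gamma density by its variable raises the shape parameter by one. -/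
lemma setIntegral_Iic_gammaMeasure {a r : ℝ} (ha : 0 < a) (hr : 0 < r) (c : ℝ) :
    ∫ x in Set.Iic c, x ∂(gammaMeasure a r) =
      a / r * (gammaMeasure (a + 1) r).real (Set.Iic c) := by
  rw [← integral_indicator measurableSet_Iic, integral_gammaMeasure ha hr,
    ← integral_indicator_one measurableSet_Iic, integral_gammaMeasure (by linarith) hr,
    ← integral_const_mul]
  refine setIntegral_congr_fun measurableSet_Ioi fun x hx ↦ ?_
  have hx : 0 < x := hx
  have hG := (Real.Gamma_pos_of_pos ha).ne'
  by_cases hxc : x ≤ c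
  · simp only [Set.indicator, Set.mem_Iic, hxc, if_true, Pi.one_apply, add_sub_cancel_right]
    rw [Real.Gamma_add_one ha.ne', Real.rpow_add hr, Real.rpow_one, Real.rpow_sub_one hx.ne']
    field_simp
  · simp [hxc]

lemma gammaMeasure_Iic_pos {a r c : ℝ} (ha : 0 < a) (hr : 0 < r) (hc : 0 < c) :
    0 < gammaMeasure a r (Set.Iic c) := by
  rw [pos_iff_ne_zero, gammaMeasure, ne_eq, withDensity_apply_eq_zero (measurable_gammaPDF a r)]
  refine fun h ↦ absurd (measure_mono_null (fun x hx ↦ ?_ : Set.Ioc 0 c ⊆ _) h) (by simpa)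
  exact ⟨(ENNReal.ofReal_pos.2 (gammaPDFReal_pos ha hr hx.1)).ne', hx.2⟩

lemma measurableSet_sum_sq_le {ι : Type*} (S : Finset ι) (a : ℝ) :
    MeasurableSet {x : ι → ℝ | ∑ j ∈ S, x j ^ 2 ≤ a} :=
  measurableSet_le (by fun_prop) (by fun_prop)

lemma sum_sq_sign_flip {ι : Type*} [DecidableEq ι] (S : Finset ι) (i : ι) (x : ι → ℝ) :
    ∑ j ∈ S, (if j = i then -x j else x j) ^ 2 = ∑ j ∈ S, x j ^ 2 :=
  Finset.sum_congr rfl fun j _ ↦ by split_ifs <;> ring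

section StandardGaussian

variable {ι : Type*} [Fintype ι]

lemma memLp_eval_pi_gaussianReal (i : ι) :
    MemLp (fun x : ι → ℝ ↦ x i) 2 (Measure.pi fun _ : ι ↦ gaussianReal 0 1) :=
  (memLp_id_gaussianReal 2).comp_measurePreserving
    (measurePreserving_eval (fun _ : ι ↦ gaussianReal 0 1) i)

lemma integrable_eval_mul_eval_pi_gaussianReal (i j : ι) :
    Integrable (fun x : ι → ℝ ↦ x i * x j) (Measure.pi fun _ : ι ↦ gaussianReal 0 1) :=
  (memLp_eval_pi_gaussianReal i).integrable_mul (memLp_eval_pi_gaussianReal j)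

lemma integral_eval_sq_pi_gaussianReal (i : ι) :
    ∫ x : ι → ℝ, x i ^ 2 ∂(Measure.pi fun _ : ι ↦ gaussianReal 0 1) = 1 := by
  have hi := measurePreserving_eval (fun _ : ι ↦ gaussianReal 0 1) i
  have hvar : Var[fun x ↦ x; gaussianReal 0 1] = 1 := by simp
  rw [variance_eq_integral aemeasurable_id'] at hvar
  rw [← hi.map_eq, integral_map hi.aemeasurable (by fun_prop)] at hvar
  simpa [hi.map_eq] using hvar

/-- A function that changes sign with the `i`-th coordinate has vanishing Gaussian integral. -/
lemma integral_pi_gaussianReal_eq_zero_of_odd [DecidableEq ι] (i : ι) {g : (ι → ℝ) → ℝ}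
    (hg : Measurable g) (hodd : ∀ x, g (fun j ↦ if j = i then -x j else x j) = -g x) :
    ∫ x, g x ∂(Measure.pi fun _ : ι ↦ gaussianReal 0 1) = 0 := by
  have hmeas (j : ι) : Measurable fun y : ℝ ↦ if j = i then -y else y := by
    split_ifs <;> fun_prop
  have hcoord (j : ι) :
      (gaussianReal 0 1).map (fun y ↦ if j = i then -y else y) = gaussianReal 0 1 := by
    split_ifs
    · simpa using gaussianReal_map_neg (μ := 0) (v := 1)
    · exact Measure.map_id
  have hprob (j : ι) : IsProbabilityMeasure
      ((gaussianReal 0 1).map (fun y ↦ if j = i then -y else y)) := by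
    rw [hcoord]; infer_instance
  have hmap := Measure.pi_map_pi (μ := fun _ : ι ↦ gaussianReal 0 1)
    (f := fun j y ↦ if j = i then -y else y) fun j ↦ (hmeas j).aemeasurable
  simp only [hcoord] at hmap
  have hint := integral_map (μ := Measure.pi fun _ : ι ↦ gaussianReal 0 1)
    (φ := fun x j ↦ if j = i then -x j else x j)
    (measurable_pi_lambda _ fun j ↦ (hmeas j).comp (measurable_pi_apply j)).aemeasurable
    hg.aestronglyMeasurable
  rw [hmap] at hint
  simp only [hodd, integral_neg] at hint
  linarith

lemma setIntegral_eval_sum_sq_le (S : Finset ι) (a : ℝ) (i : ι) :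
    ∫ x in {x : ι → ℝ | ∑ j ∈ S, x j ^ 2 ≤ a}, x i
      ∂(Measure.pi fun _ : ι ↦ gaussianReal 0 1) = 0 := by
  classical
  rw [← integral_indicator (measurableSet_sum_sq_le S a)]
  refine integral_pi_gaussianReal_eq_zero_of_odd i
    (Measurable.indicator (by fun_prop) (measurableSet_sum_sq_le S a)) fun x ↦ ?_
  simp only [Set.indicator, Set.mem_ofPred_eq, sum_sq_sign_flip, if_true]
  split_ifs <;> simp

lemma setIntegral_eval_mul_eval_sum_sq_le (S : Finset ι) (a : ℝ) {i l : ι} (hil : i ≠ l) :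
    ∫ x in {x : ι → ℝ | ∑ j ∈ S, x j ^ 2 ≤ a}, x i * x l
      ∂(Measure.pi fun _ : ι ↦ gaussianReal 0 1) = 0 := by
  classical
  rw [← integral_indicator (measurableSet_sum_sq_le S a)]
  refine integral_pi_gaussianReal_eq_zero_of_odd i
    (Measurable.indicator (by fun_prop) (measurableSet_sum_sq_le S a)) fun x ↦ ?_
  simp only [Set.indicator, Set.mem_ofPred_eq, sum_sq_sign_flip, if_true, hil.symm, if_false]
  split_ifs <;> simp

lemma measureReal_sum_sq_le {S : Finset ι} (hS : S.Nonempty) (a : ℝ) :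
    (Measure.pi fun _ : ι ↦ gaussianReal 0 1).real {x | ∑ j ∈ S, x j ^ 2 ≤ a} =
      (gammaMeasure ((#S : ℝ) / 2) (1 / 2)).real (Set.Iic a) := by
  rw [← map_sum_sq_pi_gaussianReal hS, map_measureReal_apply (by fun_prop) measurableSet_Iic]
  rfl

lemma setIntegral_eval_sq_sum_sq_le_of_notMem {S : Finset ι} (a : ℝ) {i : ι} (hi : i ∉ S) :
    ∫ x in {x : ι → ℝ | ∑ j ∈ S, x j ^ 2 ≤ a}, x i ^ 2
      ∂(Measure.pi fun _ : ι ↦ gaussianReal 0 1) =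
      (Measure.pi fun _ : ι ↦ gaussianReal 0 1).real {x | ∑ j ∈ S, x j ^ 2 ≤ a} := by
  have hindep := (iIndepFun_pi (μ := fun _ : ι ↦ gaussianReal 0 1)
    (X := fun (_ : ι) (x : ℝ) ↦ x ^ 2) (by fun_prop)).indepFun_finsetSum_of_notMem
    (by fun_prop) hi
  have hmul := hindep.integral_fun_comp_mul_comp (f := (Set.Iic a).indicator 1) (g := id)
    (Measurable.aemeasurable (by fun_prop)) (Measurable.aemeasurable (by fun_prop))
    (measurable_one.indicator measurableSet_Iic).aestronglyMeasurable (by fun_prop)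
  rw [← integral_indicator (measurableSet_sum_sq_le S a),
    ← integral_indicator_one (measurableSet_sum_sq_le S a)]
  simpa [Set.indicator, integral_eval_sq_pi_gaussianReal] using hmul

lemma setIntegral_eval_sq_sum_sq_le_of_mem {S : Finset ι} (a : ℝ) {i : ι} (hi : i ∈ S) :
    ∫ x in {x : ι → ℝ | ∑ j ∈ S, x j ^ 2 ≤ a}, x i ^ 2
      ∂(Measure.pi fun _ : ι ↦ gaussianReal 0 1) =
      (gammaMeasure ((#S : ℝ) / 2 + 1) (1 / 2)).real (Set.Iic a) := by
  classical
  set P := Measure.pi fun _ : ι ↦ gaussianReal 0 1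
  have hcard : (0 : ℝ) < #S := by exact_mod_cast Finset.card_pos.2 ⟨i, hi⟩
  have hswap (l : ι) (hl : l ∈ S) :
      ∫ x in {x : ι → ℝ | ∑ j ∈ S, x j ^ 2 ≤ a}, x l ^ 2 ∂P =
        ∫ x in {x : ι → ℝ | ∑ j ∈ S, x j ^ 2 ≤ a}, x i ^ 2 ∂P := by
    have he := measurePreserving_arrowCongr' (fun _ : ι ↦ gaussianReal 0 1)
      (fun _ : ι ↦ gaussianReal 0 1) (Equiv.swap i l) (MeasurableEquiv.refl ℝ)
      fun _ ↦ MeasurePreserving.id _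
    rw [← he.setIntegral_preimage_emb (MeasurableEquiv.measurableEmbedding _)]
    have hsum (x : ι → ℝ) : ∑ j ∈ S, x (Equiv.swap i l j) ^ 2 = ∑ j ∈ S, x j ^ 2 := by
      refine Finset.sum_equiv (Equiv.swap i l) (fun j ↦ ?_) fun _ _ ↦ rfl
      rcases eq_or_ne j i with rfl | hji
      · simp [hi, hl]
      rcases eq_or_ne j l with rfl | hjl
      · simp [hi, hl]
      rw [Equiv.swap_apply_of_ne_of_ne hji hjl]
    simp [MeasurableEquiv.arrowCongr', Equiv.arrowCongr', Set.preimage, hsum, P]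
  have htotal : ∑ l ∈ S, ∫ x in {x : ι → ℝ | ∑ j ∈ S, x j ^ 2 ≤ a}, x l ^ 2 ∂P =
      #S * (gammaMeasure ((#S : ℝ) / 2 + 1) (1 / 2)).real (Set.Iic a) := by
    have hint (l : ι) : Integrable (fun x : ι → ℝ ↦ x l ^ 2) P := by
      simpa only [sq] using integrable_eval_mul_eval_pi_gaussianReal l l
    rw [← integral_finsetSum _ fun l _ ↦ (hint l).integrableOn]
    have h := setIntegral_Iic_gammaMeasure (half_pos hcard) (r := 1 / 2) (by norm_num) a
    rw [← map_sum_sq_pi_gaussianReal ⟨i, hi⟩,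
      setIntegral_map measurableSet_Iic (by fun_prop) (Measurable.aemeasurable (by fun_prop))] at h
    refine h.trans ?_
    ring
  rw [Finset.sum_congr rfl hswap, Finset.sum_const, nsmul_eq_mul] at htotal
  exact mul_left_cancel₀ hcard.ne' htotal

end StandardGaussian

/-- Integrals of functions of a random vector conditioned on an event determined by that vector. -/
lemma integral_cond_comp {Ω E : Type*} [MeasurableSpace Ω] [MeasurableSpace E] {μ : Measure Ω}
    {w : Ω → E} (hw : Measurable w) {B : Set E} (hB : MeasurableSet B)
    {f : E → ℝ} (hf : Measurable f) :
    ∫ ω, f (w ω) ∂(μ[|w ⁻¹' B]) = ((μ.map w).real B)⁻¹ * ∫ x in B, f x ∂(μ.map w) := by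
  rw [setIntegral_map hB hf.aestronglyMeasurable hw.aemeasurable, ProbabilityTheory.cond,
    integral_smul_measure, map_measureReal_apply hw hB, ENNReal.toReal_inv, smul_eq_mul]
  rfl

/-- Second moments of a linear image of a standard Gaussian vector restricted to
`∑ j ∈ S, x j ^ 2 ≤ a`. -/
lemma setIntegral_mul_linear_sum_sq_le {ι : Type*} [Fintype ι] {S : Finset ι} (a : ℝ)
    (b c : ι → ℝ) :
    ∫ x in {x : ι → ℝ | ∑ j ∈ S, x j ^ 2 ≤ a}, (∑ l, b l * x l) * (∑ l, c l * x l)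
      ∂(Measure.pi fun _ : ι ↦ gaussianReal 0 1) =
      ∑ l, b l * c l * ∫ x in {x : ι → ℝ | ∑ j ∈ S, x j ^ 2 ≤ a}, x l ^ 2
        ∂(Measure.pi fun _ : ι ↦ gaussianReal 0 1) := by
  have hint (l m : ι) : Integrable (fun x : ι → ℝ ↦ b l * c m * (x l * x m))
      ((Measure.pi fun _ : ι ↦ gaussianReal 0 1).restrict {x | ∑ j ∈ S, x j ^ 2 ≤ a}) :=
    ((integrable_eval_mul_eval_pi_gaussianReal l m).const_mul _).integrableOn
  simp_rw [Finset.sum_mul_sum, mul_mul_mul_comm]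
  rw [integral_finsetSum _ fun l _ ↦ integrable_finsetSum _ fun m _ ↦ hint l m]
  refine Finset.sum_congr rfl fun l _ ↦ ?_
  rw [integral_finsetSum _ fun m _ ↦ hint l m, Finset.sum_eq_single l]
  · rw [integral_const_mul]
    simp_rw [sq]
  · intro m _ hml
    rw [integral_const_mul, setIntegral_eval_mul_eval_sum_sq_le S a hml.symm, mul_zero]
  · simp

lemma setIntegral_linear_sum_sq_le {ι : Type*} [Fintype ι] {S : Finset ι} (a : ℝ) (b : ι → ℝ) :
    ∫ x in {x : ι → ℝ | ∑ j ∈ S, x j ^ 2 ≤ a}, ∑ l, b l * x l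
      ∂(Measure.pi fun _ : ι ↦ gaussianReal 0 1) = 0 := by
  rw [integral_finsetSum _ fun l _ ↦ (((memLp_eval_pi_gaussianReal l).integrable
    one_le_two).const_mul _).integrableOn]
  simp [integral_const_mul, setIntegral_eval_sum_sq_le]

/-- Dividing independent centered Gaussian coordinates by their standard deviations yields
independent standard Gaussian coordinates. -/
lemma map_div_pi_gaussianReal {ι : Type*} [Fintype ι] {s : ι → ℝ} (hs : ∀ j, 0 < s j) :
    (Measure.pi fun j ↦ gaussianReal 0 (s j ^ 2).toNNReal).map (fun x j ↦ x j / s j) =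
      Measure.pi fun _ ↦ gaussianReal 0 1 := by
  have hcoord (j : ι) : (gaussianReal 0 (s j ^ 2).toNNReal).map (fun y ↦ y / s j) =
      gaussianReal 0 1 := by
    rw [gaussianReal_map_div_const, zero_div]
    congr 1
    ext
    have := (hs j).ne'
    simp [sq_nonneg, this]
  have hprob (j : ι) : IsProbabilityMeasure
      ((gaussianReal 0 (s j ^ 2).toNNReal).map (fun y ↦ y / s j)) := by
    rw [hcoord]; infer_instance
  rw [Measure.pi_map_pi (f := fun j y ↦ y / s j) fun j ↦ by fun_prop]
  simp only [hcoord]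

/-- covariance reduction for PCA rerandomization. Let
`Σ = C_n V D² Vᵀ` with `V` orthogonal, `D = diag(σ₁,…,σ_d)`, `σ₁ ≥ … ≥ σ_d > 0`,
`C_n = 4/(n²−n)`, and `ξ ~ N(0, Σ)` (formalized as the pushforward under `V` of the
product of centered Gaussians with variances `C_n σ_j²`). With
`M_k = ∑_{j<k} (Vᵀξ)_j²/(C_n σ_j²)`, `a_k > 0`, and
`v = P(χ²_{k+2} ≤ a_k)/P(χ²_k ≤ a_k)`, the conditional covariance matrix of `ξ`
given `{M_k ≤ a_k}` equals `C_n · V · diag(v σ₁²,…,v σ_k², σ_{k+1}²,…,σ_d²) · Vᵀ`. -/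
theorem pca_rerandomization_cov_reduction
    {Ω : Type*} [MeasurableSpace Ω] (μ : Measure Ω) [IsProbabilityMeasure μ]
    (d k n : ℕ) (hk1 : 1 ≤ k) (hkd : k ≤ d) (hn : 2 ≤ n)
    (Cn : ℝ) (hCn : Cn = 4 / ((n : ℝ) ^ 2 - n))
    (V : Matrix (Fin d) (Fin d) ℝ) (hV : Vᵀ * V = 1)
    (σ : Fin d → ℝ) (hσpos : ∀ j, 0 < σ j)
    (hσmono : ∀ i j : Fin d, i ≤ j → σ j ≤ σ i)
    (ξ : Ω → Fin d → ℝ) (hξ : Measurable ξ)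
    (hlaw : Measure.map ξ μ =
      Measure.map (fun z => V.mulVec z)
        (Measure.pi fun j => gaussianReal 0 (Cn * (σ j) ^ 2).toNNReal))
    (Mk : Ω → ℝ)
    (hMk : ∀ ω, Mk ω = ∑ j ∈ Finset.univ.filter (fun j : Fin d => (j : ℕ) < k),
      (Vᵀ.mulVec (ξ ω) j) ^ 2 / (Cn * (σ j) ^ 2))
    (ak : ℝ) (hak : 0 < ak)
    (v : ℝ) (hv : v = chiSqCDF (k + 2) ak / chiSqCDF k ak) :
    ∀ i j : Fin d,
      (∫ ω, ξ ω i * ξ ω j ∂(μ[|{ω | Mk ω ≤ ak}])) -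
        (∫ ω, ξ ω i ∂(μ[|{ω | Mk ω ≤ ak}])) * (∫ ω, ξ ω j ∂(μ[|{ω | Mk ω ≤ ak}])) =
      Cn * (V * Matrix.diagonal
        (fun l : Fin d => if (l : ℕ) < k then v * (σ l) ^ 2 else (σ l) ^ 2) * Vᵀ) i j := by
  have hn' : (2 : ℝ) ≤ n := by exact_mod_cast hn
  have hC : 0 < Cn := by
    rw [hCn]
    exact div_pos (by norm_num) (by nlinarith)
  set S : Finset (Fin d) := Finset.univ.filter fun j : Fin d ↦ (j : ℕ) < k with hS_def
  have hcard : #S = k := by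
    rw [hS_def, Fin.card_filter_val_lt, min_eq_right hkd]
  have hS : S.Nonempty := Finset.card_pos.1 (by omega)
  set s : Fin d → ℝ := fun l ↦ √Cn * σ l
  have hs (l : Fin d) : 0 < s l := mul_pos (Real.sqrt_pos.2 hC) (hσpos l)
  have hs2 (l : Fin d) : s l ^ 2 = Cn * σ l ^ 2 := by rw [mul_pow, Real.sq_sqrt hC.le]
  set w : Ω → Fin d → ℝ := fun ω l ↦ (Vᵀ *ᵥ ξ ω) l / s l
  have hmulVec (M : Matrix (Fin d) (Fin d) ℝ) : Measurable fun x : Fin d → ℝ ↦ M *ᵥ x := by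
    unfold Matrix.mulVec dotProduct
    fun_prop
  have hdiv : Measurable fun (x : Fin d → ℝ) l ↦ x l / s l := by fun_prop
  have hw : Measurable w := hdiv.comp ((hmulVec Vᵀ).comp hξ)
  have hwlaw : μ.map w = Measure.pi fun _ ↦ gaussianReal 0 1 := by
    rw [← map_div_pi_gaussianReal hs]
    simp_rw [hs2]
    change μ.map ((fun (x : Fin d → ℝ) l ↦ x l / s l) ∘ (fun x ↦ Vᵀ *ᵥ x) ∘ ξ) = _
    rw [← Measure.map_map hdiv ((hmulVec _).comp hξ), ← Measure.map_map (hmulVec _) hξ, hlaw,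
      Measure.map_map (hmulVec _) (hmulVec _)]
    simp [Function.comp_def, hV]
  set B : Set (Fin d → ℝ) := {x | ∑ j ∈ S, x j ^ 2 ≤ ak}
  have hB : MeasurableSet B := measurableSet_sum_sq_le S ak
  have hevent : {ω | Mk ω ≤ ak} = w ⁻¹' B := by
    ext ω
    simp [hMk, B, w, div_pow, hs2]
  have hξw (ω : Ω) (i : Fin d) : ξ ω i = ∑ l, V i l * s l * w ω l := by
    have hinv : V *ᵥ (Vᵀ *ᵥ ξ ω) = ξ ω := by
      rw [Matrix.mulVec_mulVec, mul_eq_one_comm.1 hV, Matrix.one_mulVec]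
    conv_lhs => rw [← hinv]
    change ∑ l, V i l * (Vᵀ *ᵥ ξ ω) l = _
    refine Finset.sum_congr rfl fun l _ ↦ ?_
    rw [mul_assoc, mul_div_cancel₀ _ (hs l).ne']
  have hpos : 0 < chiSqCDF k ak := ENNReal.toReal_pos
    (gammaMeasure_Iic_pos (by positivity) (by norm_num) hak).ne' (by
      have := isProbabilityMeasure_gammaMeasure (a := (k : ℝ) / 2) (r := 1 / 2)
        (by positivity) (by norm_num)
      exact measure_ne_top _ _)
  have hPB : (Measure.pi fun _ : Fin d ↦ gaussianReal 0 1).real B = chiSqCDF k ak := by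
    rw [measureReal_sum_sq_le hS, hcard]
    rfl
  have hsecond (l : Fin d) :
      ∫ x in B, x l ^ 2 ∂(Measure.pi fun _ : Fin d ↦ gaussianReal 0 1) =
        chiSqCDF k ak * if (l : ℕ) < k then v else 1 := by
    split_ifs with hl
    · rw [setIntegral_eval_sq_sum_sq_le_of_mem ak (by simpa [hS_def] using hl), hcard, hv,
        mul_div_cancel₀ _ hpos.ne', chiSqCDF, Nat.cast_add, Nat.cast_ofNat, add_div,
        div_self two_ne_zero]
      rfl
    · rw [setIntegral_eval_sq_sum_sq_le_of_notMem ak (by simpa [hS_def] using hl), hPB, mul_one]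
  intro i j
  rw [hevent]
  simp_rw [hξw]
  rw [integral_cond_comp hw hB (f := fun x ↦ (∑ l, V i l * s l * x l) * ∑ l, V j l * s l * x l)
      (by fun_prop),
    integral_cond_comp hw hB (f := fun x ↦ ∑ l, V i l * s l * x l) (by fun_prop), hwlaw,
    setIntegral_linear_sum_sq_le, setIntegral_mul_linear_sum_sq_le, hPB, mul_zero, zero_mul,
    sub_zero, Matrix.mul_apply, Finset.mul_sum, Finset.mul_sum]
  refine Finset.sum_congr rfl fun l _ ↦ ?_
  rw [hsecond, Matrix.mul_diagonal, Matrix.transpose_apply]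
  have := hpos.ne'
  split_ifs <;> field_simp <;> rw [hs2] <;> ring
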